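/- Any A-module X with Ext¹_A(A ⊕ D(A), X) = 0 lies in add(A ⊕ D(A)); that is, {X ∈ mod-A : Ext¹_A(A ⊕ D(A), X) = 0} ⊆ add(A ⊕ D(A)). -/

import Mathlib

/-!
We formalize statements about the algebra `A = kQ/J²`, where `Q` is the quiver
`1 ⇄ 2 ⇄ 3` and `J` is the arrow ideal of the path algebra `kQ`.
The algebra `A` is presented by generators and relations as a quotient of the
free algebra on three vertex idempotents and four arrows.
Right `A`-modules are treated as left modules over `Aᵐᵒᵖ`.
-/

open CategoryTheory Opposite

/-- Generators of the path algebra `kQ`: three vertex idempotents `e i`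
and four arrows `ar a`, where the arrows of `Q` are
`α : 1 → 2`, `β : 2 → 1`, `γ : 2 → 3`, `δ : 3 → 2`. -/
inductive QGen : Type
  | e : Fin 3 → QGen
  | ar : Fin 4 → QGen

/-- The sources of the four arrows `α, β, γ, δ` (vertices `1,2,3` are `0,1,2 : Fin 3`). -/
def arrowSrc : Fin 4 → Fin 3 := ![0, 1, 1, 2]

/-- The targets of the four arrows `α, β, γ, δ`. -/
def arrowTgt : Fin 4 → Fin 3 := ![1, 0, 2, 1]

/-- The defining relations of `A = kQ/J²`: the `e i` are orthogonal idempotents summing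
to `1`, the arrows are compatible with their sources and targets, and any product of
two arrows vanishes (`J² = 0`). -/
inductive ARel (k : Type) [Field k] : FreeAlgebra k QGen → FreeAlgebra k QGen → Prop
  | idem (i j : Fin 3) :
      ARel k (FreeAlgebra.ι k (QGen.e i) * FreeAlgebra.ι k (QGen.e j))
        (if i = j then FreeAlgebra.ι k (QGen.e i) else 0)
  | sum : ARel k
      (FreeAlgebra.ι k (QGen.e 0) + FreeAlgebra.ι k (QGen.e 1) + FreeAlgebra.ι k (QGen.e 2)) 1
  | src (a : Fin 4) :
      ARel k (FreeAlgebra.ι k (QGen.e (arrowSrc a)) * FreeAlgebra.ι k (QGen.ar a))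
        (FreeAlgebra.ι k (QGen.ar a))
  | tgt (a : Fin 4) :
      ARel k (FreeAlgebra.ι k (QGen.ar a) * FreeAlgebra.ι k (QGen.e (arrowTgt a)))
        (FreeAlgebra.ι k (QGen.ar a))
  | radsq (a b : Fin 4) :
      ARel k (FreeAlgebra.ι k (QGen.ar a) * FreeAlgebra.ι k (QGen.ar b)) 0

/-- The algebra `A = kQ/J²`. -/
abbrev AlgA (k : Type) [Field k] : Type := RingQuot (ARel k)

/-- Right `A`-modules are left modules over `Aop k = Aᵐᵒᵖ`. -/
abbrev Aop (k : Type) [Field k] : Type := (AlgA k)ᵐᵒᵖ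

/-- The algebra homomorphism `A → k` corresponding to the vertex `i`. -/
noncomputable def simpleAlgHom (k : Type) [Field k] (i : Fin 3) : AlgA k →ₐ[k] k :=
  RingQuot.liftAlgHom k
    ⟨FreeAlgebra.lift k (fun g => match g with
        | QGen.e j => if j = i then (1 : k) else 0
        | QGen.ar _ => 0), by
      intro _x _y h
      induction h with
      | idem i j =>
          simp only [map_mul, FreeAlgebra.lift_ι_apply, apply_ite, map_zero]
          split_ifs <;> simp_all
      | sum =>
          simp only [map_add, map_one, FreeAlgebra.lift_ι_apply]
          fin_cases i <;> simp
      | src a => simp [FreeAlgebra.lift_ι_apply]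
      | tgt a => simp [FreeAlgebra.lift_ι_apply]
      | radsq a b => simp [FreeAlgebra.lift_ι_apply]⟩

/-- The ring homomorphism `Aᵐᵒᵖ → k` corresponding to the vertex `i`. -/
noncomputable def simpleRingHom (k : Type) [Field k] (i : Fin 3) : Aop k →+* k :=
  RingHom.fromOpposite (simpleAlgHom k i).toRingHom (fun _ _ => mul_comm _ _)

/-- The simple right `A`-module `S_{i+1}` at the vertex `i` (one-dimensional over `k`,
with `e i` acting as the identity and all arrows acting by zero).
So `SimpleS k 0 = S₁`, `SimpleS k 1 = S₂` and `SimpleS k 2 = S₃`. -/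
def SimpleS (k : Type) [Field k] (_i : Fin 3) : Type := k

instance (k : Type) [Field k] (i : Fin 3) : AddCommGroup (SimpleS k i) :=
  inferInstanceAs (AddCommGroup k)

instance (k : Type) [Field k] (i : Fin 3) : Module k (SimpleS k i) :=
  inferInstanceAs (Module k k)

noncomputable instance (k : Type) [Field k] (i : Fin 3) : Module (Aop k) (SimpleS k i) :=
  Module.compHom (SimpleS k i) (simpleRingHom k i)

/-- The underlying type of `D(A) = Hom_k(A, k)`. -/
abbrev DualA (k : Type) [Field k] : Type := AlgA k →ₗ[k] k

/-- The right `A`-module structure on `D(A)`: `(φ · a) x = φ (a * x)`. -/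
noncomputable instance (k : Type) [Field k] : Module (Aop k) (DualA k) where
  smul a φ := φ.comp (LinearMap.mulLeft k a.unop)
  one_smul φ := by
    show φ.comp (LinearMap.mulLeft k ((1 : Aop k).unop)) = φ
    ext x; simp
  mul_smul a b φ := by
    show φ.comp (LinearMap.mulLeft k ((a * b).unop)) =
      (φ.comp (LinearMap.mulLeft k b.unop)).comp (LinearMap.mulLeft k a.unop)
    ext x; simp [mul_assoc]
  smul_zero a := by
    show (0 : DualA k).comp (LinearMap.mulLeft k a.unop) = 0
    ext x; simp
  smul_add a φ ψ := by
    show (φ + ψ).comp (LinearMap.mulLeft k a.unop) =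
      φ.comp (LinearMap.mulLeft k a.unop) + ψ.comp (LinearMap.mulLeft k a.unop)
    ext x; simp
  add_smul a b φ := by
    show φ.comp (LinearMap.mulLeft k ((a + b).unop)) =
      φ.comp (LinearMap.mulLeft k a.unop) + φ.comp (LinearMap.mulLeft k b.unop)
    ext x; simp [add_mul]
  zero_smul φ := by
    show φ.comp (LinearMap.mulLeft k ((0 : Aop k).unop)) = 0
    ext x; simp

/-- The right `A`-module `M = A ⊕ D(A)`, where `A` carries the right regular
`A`-module structure. -/
abbrev MA (k : Type) [Field k] : Type := AlgA k × DualA k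

/-- `X` belongs to `add M`: `X` is (isomorphic to) a direct summand of `Mⁿ` for some `n`. -/
def InAdd (k : Type) [Field k] (M X : Type) [AddCommGroup M] [Module (Aop k) M]
    [AddCommGroup X] [Module (Aop k) X] : Prop :=
  ∃ (n : ℕ) (ι : X →ₗ[Aop k] (Fin n → M)) (π : (Fin n → M) →ₗ[Aop k] X),
    π.comp ι = LinearMap.id

/-- `Ext^i_A(X, Y)` for right `A`-modules `X` and `Y`, computed in the abelian
category of all right `A`-modules (which has the same `Ext` groups as `mod A`). -/
noncomputable def ExtA (k : Type) [Field k] (X Y : Type) [AddCommGroup X] [Module (Aop k) X]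
    [AddCommGroup Y] [Module (Aop k) Y] (i : ℕ) : Type :=
  ((Ext ℤ (ModuleCat (Aop k)) i).obj (op (ModuleCat.of (Aop k) X))).obj (ModuleCat.of (Aop k) Y)

theorem CategoryTheory.ProjectiveResolution.exists_comp_eq_of_subsingleton_ext
    {C : Type*} [Category* C] [Abelian C] [EnoughProjectives C] {M X : C}
    (P : ProjectiveResolution M)
    (h : Subsingleton (((Ext ℤ C 1).obj (op M)).obj X))
    (t : P.complex.X 1 ⟶ X) (ht : P.complex.d 2 1 ≫ t = 0) :
    ∃ s : P.complex.X 0 ⟶ X, P.complex.d 1 0 ≫ s = t := by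
  have h0 : Limits.IsZero ((P.complex.linearYonedaObj ℤ X).homology 1) :=
    (ModuleCat.isZero_of_subsingleton _).of_iso (P.isoExt 1 X).symm
  rw [← HomologicalComplex.exactAt_iff_isZero_homology,
    HomologicalComplex.exactAt_iff' _ 0 1 2 (by simp) (by simp),
    ShortComplex.moduleCat_exact_iff] at h0
  obtain ⟨s, hs⟩ := h0 t ht
  exact ⟨s, hs⟩

theorem CategoryTheory.exists_section_of_subsingleton_ext
    {C : Type*} [Category* C] [Abelian C] [EnoughProjectives C] {M X E : C}
    (h : Subsingleton (((Ext ℤ C 1).obj (op M)).obj X))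
    (i : X ⟶ E) (p : E ⟶ M) (w : i ≫ p = 0) (hS : (ShortComplex.mk i p w).ShortExact) :
    ∃ σ : M ⟶ E, σ ≫ p = 𝟙 M := by
  let P := ProjectiveResolution.of M
  have : Mono i := hS.mono_f
  have : Epi p := hS.epi_g
  let π : P.complex.X 0 ⟶ M := P.π.f 0
  have hπ : P.complex.d 1 0 ≫ π = 0 := P.complex_d_comp_π_f_zero
  have hπ_epi : Epi π := inferInstanceAs (Epi (P.π.f 0))
  have hl : Projective.factorThru π p ≫ p = π := Projective.factorThru_comp _ _
  set l : P.complex.X 0 ⟶ E := Projective.factorThru π p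
  have hd : (P.complex.d 1 0 ≫ l) ≫ p = 0 := by rw [Category.assoc, hl, hπ]
  let t : P.complex.X 1 ⟶ X := hS.exact.lift (P.complex.d 1 0 ≫ l) hd
  have ht : t ≫ i = P.complex.d 1 0 ≫ l := hS.exact.lift_f _ hd
  obtain ⟨s, hs⟩ := P.exists_comp_eq_of_subsingleton_ext h t (by
    rw [← cancel_mono i, Category.assoc, ht]; simp)
  let σ : M ⟶ E := P.isColimitCokernelCofork.desc
    (Limits.CokernelCofork.ofπ (l - s ≫ i) (by
      rw [Preadditive.comp_sub, ← Category.assoc, hs, ht, sub_self]))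
  have hσ : π ≫ σ = l - s ≫ i :=
    P.isColimitCokernelCofork.fac _ Limits.WalkingParallelPair.one
  refine ⟨σ, ?_⟩
  rw [← cancel_epi π, ← Category.assoc, hσ]
  simp [Preadditive.sub_comp, hl, w]

/-- The extension of the module `Y` by the module `X` with additive group `X × Y` which is
determined by a cocycle `c`. -/
def CocycleExtension {R X Y : Type*} [Ring R] [AddCommGroup X] [Module R X] [AddCommGroup Y]
    [Module R Y] (c : R →+ Y →+ X) (_hc : ∀ r s y, c (r * s) y = r • c s y + c r (s • y)) :
    Type _ :=
  X × Y

namespace CocycleExtension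

variable {R X Y : Type*} [Ring R] [AddCommGroup X] [Module R X] [AddCommGroup Y] [Module R Y]
  (c : R →+ Y →+ X) (hc : ∀ r s y, c (r * s) y = r • c s y + c r (s • y))

instance : AddCommGroup (CocycleExtension c hc) :=
  inferInstanceAs (AddCommGroup (X × Y))

instance : Module R (CocycleExtension c hc) where
  smul r z := (r • z.1 + c r z.2, r • z.2)
  one_smul z := by
    have h := hc 1 1 z.2
    simp only [mul_one, one_smul, left_eq_add] at h
    exact Prod.ext (show (1 : R) • z.1 + c 1 z.2 = z.1 by rw [h, one_smul, add_zero])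
      (one_smul R z.2)
  mul_smul r s z := Prod.ext
    (show (r * s) • z.1 + c (r * s) z.2 = r • (s • z.1 + c s z.2) + c r (s • z.2) by
      rw [hc, mul_smul, smul_add, add_assoc]) (mul_smul r s z.2)
  smul_zero r := Prod.ext (show r • (0 : X) + c r 0 = 0 by simp) (smul_zero r)
  smul_add r y z := Prod.ext
    (show r • (y.1 + z.1) + c r (y.2 + z.2) = (r • y.1 + c r y.2) + (r • z.1 + c r z.2) by
      rw [smul_add, map_add]; abel) (smul_add r y.2 z.2)
  add_smul r s z := Prod.ext
    (show (r + s) • z.1 + c (r + s) z.2 = (r • z.1 + c r z.2) + (s • z.1 + c s z.2) by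
      rw [add_smul, map_add, AddMonoidHom.add_apply]; abel) (add_smul r s z.2)
  zero_smul z := Prod.ext (show (0 : R) • z.1 + c 0 z.2 = 0 by simp) (zero_smul R z.2)

/-- The inclusion of the submodule `X`. -/
def inl : X →ₗ[R] CocycleExtension c hc where
  toFun x := (x, 0)
  map_add' x y := Prod.ext rfl (add_zero 0).symm
  map_smul' r x := Prod.ext (show r • x = r • x + c r 0 by simp) (smul_zero r).symm

/-- The projection onto the quotient `Y`. -/
def snd : CocycleExtension c hc →ₗ[R] Y where
  toFun z := z.2
  map_add' _ _ := rfl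
  map_smul' _ _ := rfl

end CocycleExtension

/-- If `Ext¹(Y, X)` vanishes, then every cocycle is a coboundary. -/
theorem exists_coboundary_of_subsingleton_ext {R X Y : Type} [Ring R] [AddCommGroup X]
    [Module R X] [AddCommGroup Y] [Module R Y]
    (h : Subsingleton
      (((Ext ℤ (ModuleCat R) 1).obj (op (ModuleCat.of R Y))).obj (ModuleCat.of R X)))
    (c : R →+ Y →+ X) (hc : ∀ r s y, c (r * s) y = r • c s y + c r (s • y)) :
    ∃ σ : Y →+ X, ∀ r y, σ (r • y) = r • σ y + c r y := by
  let i := ModuleCat.ofHom (CocycleExtension.inl c hc)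
  let p := ModuleCat.ofHom (CocycleExtension.snd c hc)
  have w : i ≫ p = 0 := rfl
  have hex : (ShortComplex.mk i p w).Exact := by
    rw [ShortComplex.moduleCat_exact_iff]
    intro z hz
    exact ⟨Prod.fst z, Prod.ext rfl hz.symm⟩
  have hi : Mono i := (ModuleCat.mono_iff_injective i).2 fun x y hxy => congrArg Prod.fst hxy
  have hp : Epi p := (ModuleCat.epi_iff_surjective p).2 fun y => ⟨((0 : X), y), rfl⟩
  obtain ⟨σ, hσ⟩ := exists_section_of_subsingleton_ext h i p w ⟨hex⟩
  have hσ₂ (y : Y) : Prod.snd (σ.hom y) = y := congr(ModuleCat.Hom.hom $hσ y)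
  refine ⟨⟨⟨fun y => Prod.fst (σ.hom y), congrArg Prod.fst (map_zero σ.hom)⟩,
    fun y z => congrArg Prod.fst (map_add σ.hom y z)⟩, fun r y => ?_⟩
  have h₁ : Prod.fst (σ.hom (r • y)) = r • Prod.fst (σ.hom y) + c r (Prod.snd (σ.hom y)) :=
    congrArg Prod.fst (map_smul σ.hom r y)
  rwa [hσ₂] at h₁

namespace LinearMap

variable {K U V W : Type*} [Field K] [AddCommGroup U] [Module K U] [AddCommGroup V] [Module K V]
  [AddCommGroup W] [Module K W]

theorem exists_comp_eq_of_ker_le_ker (f : U →ₗ[K] V) (g : U →ₗ[K] W) (h : ker f ≤ ker g) :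
    ∃ q : V →ₗ[K] W, q ∘ₗ f = g := by
  obtain ⟨q, hq⟩ := ((ker f).liftQ g h ∘ₗ f.quotKerEquivRange.symm.toLinearMap).exists_extend
  refine ⟨q, ext fun x => ?_⟩
  have := congr($hq (f.rangeRestrict x))
  have hx : f.quotKerEquivRange.symm (f.rangeRestrict x) = (ker f).mkQ x :=
    f.quotKerEquivRange.symm_apply_eq.2 (Subtype.ext rfl)
  simpa [hx] using this

theorem exists_comp_eq_of_range_le_range (f : V →ₗ[K] W) (g : U →ₗ[K] W)
    (h : range g ≤ range f) : ∃ q : U →ₗ[K] V, f ∘ₗ q = g := by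
  obtain ⟨r, hr⟩ := f.rangeRestrict.exists_rightInverse_of_surjective f.range_rangeRestrict
  refine ⟨r ∘ₗ g.codRestrict (range f) fun x => h ⟨x, rfl⟩, ext fun x => ?_⟩
  exact congrArg Subtype.val congr($hr ⟨g x, h ⟨x, rfl⟩⟩)

theorem exists_isIdempotent_range (S : Submodule K V) :
    ∃ u : V →ₗ[K] V, (∀ x, u x ∈ S) ∧ ∀ x ∈ S, u x = x := by
  obtain ⟨r, hr⟩ := S.subtype.exists_leftInverse_of_injective S.ker_subtype
  exact ⟨S.subtype ∘ₗ r, fun x => (r x).2, fun x hx => congrArg Subtype.val congr($hr ⟨x, hx⟩)⟩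

theorem exists_quasiInverse_on (f : U →ₗ[K] V) (S : Submodule K U) :
    ∃ h : V →ₗ[K] U, (∀ y, h y ∈ S) ∧ ∀ x ∈ S, f (h (f x)) = f x := by
  obtain ⟨u, hu, huS⟩ := exists_isIdempotent_range (S.map f)
  obtain ⟨h, hh⟩ := exists_comp_eq_of_range_le_range (f ∘ₗ S.subtype) u (by
    rintro _ ⟨y, rfl⟩
    obtain ⟨x, hx, hxy⟩ := hu y
    exact ⟨⟨x, hx⟩, hxy⟩)
  refine ⟨S.subtype ∘ₗ h, fun y => (h y).2, fun x hx => ?_⟩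
  have := congr($hh (f x))
  rw [huS _ ⟨x, hx, rfl⟩] at this
  exact this

theorem exists_quasiInverse_pair_of_source (f : U →ₗ[K] V) (g : U →ₗ[K] W) :
    ∃ (p h : V →ₗ[K] U) (q h' : W →ₗ[K] U), g ∘ₗ h = 0 ∧ f ∘ₗ h' = 0 ∧ p ∘ₗ f = q ∘ₗ g ∧
      f ∘ₗ (p + h) ∘ₗ f = f ∧ g ∘ₗ (q + h') ∘ₗ g = g := by
  obtain ⟨h, hg, hf⟩ := exists_quasiInverse_on f (ker g)
  obtain ⟨h', hf', hg'⟩ := exists_quasiInverse_on g (ker f)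
  obtain ⟨u, hu, huS⟩ := exists_isIdempotent_range (ker f ⊔ ker g)
  have hg₀ (y) : g (h y) = 0 := hg y
  have hf₀ (y) : f (h' y) = 0 := hf' y
  let w : U →ₗ[K] U := (id - h ∘ₗ f - h' ∘ₗ g) ∘ₗ (id - u)
  have hfu (x) : f (u x) - f (h (f (u x))) = 0 := by
    obtain ⟨y, hy, z, hz, hyz⟩ := Submodule.mem_sup.1 (hu x)
    rw [mem_ker] at hy
    simp [← hyz, hy, hf z hz]
  have hgu (x) : g (u x) - g (h' (g (u x))) = 0 := by
    obtain ⟨y, hy, z, hz, hyz⟩ := Submodule.mem_sup.1 (hu x)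
    rw [mem_ker] at hz
    simp [← hyz, hz, hg' y hy]
  have hfw (x) : f (w x) = f x - f (h (f x)) := by
    have := hfu x
    simp only [w, comp_apply, sub_apply, id_apply, map_sub, hf₀, sub_zero] at this ⊢
    rw [← sub_eq_zero, ← neg_eq_zero, ← this]; abel
  have hgw (x) : g (w x) = g x - g (h' (g x)) := by
    have := hgu x
    simp only [w, comp_apply, sub_apply, id_apply, map_sub, hg₀, sub_zero] at this ⊢
    rw [← sub_eq_zero, ← neg_eq_zero, ← this]; abel
  have hw (x) (hx : x ∈ ker f ⊔ ker g) : w x = 0 := by simp [w, huS x hx]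
  obtain ⟨p, hp⟩ := exists_comp_eq_of_ker_le_ker f w fun x hx => hw x (le_sup_left (b := ker g) hx)
  obtain ⟨q, hq⟩ := exists_comp_eq_of_ker_le_ker g w fun x hx => hw x (le_sup_right (a := ker f) hx)
  refine ⟨p, h, q, h', ext hg₀, ext hf₀, hp.trans hq.symm, ext fun x => ?_, ext fun x => ?_⟩
  · have := congr(f ($hp x))
    simp only [comp_apply, add_apply, map_add] at this ⊢
    rw [this, hfw, sub_add_cancel]
  · have := congr(g ($hq x))
    simp only [comp_apply, add_apply, map_add] at this ⊢
    rw [this, hgw, sub_add_cancel]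

theorem exists_comp_quasiInverse_eq (f : U →ₗ[K] W) (g : V →ₗ[K] W) (u : W →ₗ[K] W)
    (hu : ∀ x, u x ∈ range f) (hu' : ∀ x ∈ range f ⊓ range g, u x = x) :
    ∃ p : W →ₗ[K] U, p ∘ₗ g = 0 ∧ ∀ x, f (p (f x)) = f x - u (f x) := by
  have hmem (x) : f x - u (f x) ∈ range f := sub_mem ⟨x, rfl⟩ (hu _)
  obtain ⟨r, hr⟩ := exists_comp_eq_of_range_le_range f (f - u ∘ₗ f)
    (by rintro _ ⟨x, rfl⟩; exact hmem x)
  obtain ⟨e, he, heS⟩ := exists_isIdempotent_range (ker f)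
  obtain ⟨p, hp⟩ := exists_comp_eq_of_ker_le_ker (f.coprod g)
    ((r - e ∘ₗ r) ∘ₗ fst K U V) (by
      rintro ⟨x, y⟩ hxy
      have hxy : f x + g y = 0 := hxy
      have hux : u (f x) = f x :=
        hu' _ ⟨⟨x, rfl⟩, ⟨-y, by rw [map_neg, eq_comm]; exact eq_neg_of_add_eq_zero_left hxy⟩⟩
      have hrx : f (r x) = 0 := by
        have := congr($hr x)
        simpa [hux] using this
      simp [heS _ hrx])
  refine ⟨p, ext fun y => ?_, fun x => ?_⟩
  · have := congr($hp (0, y))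
    simpa using this
  · have h₁ := congr(f ($hp (x, 0)))
    have h₂ := congr($hr x)
    have h₃ : f (e (r x)) = 0 := he _
    simp only [comp_apply, coprod_apply, map_zero, add_zero, fst_apply, sub_apply, map_sub] at h₁ h₂
    rw [h₁, h₃, sub_zero, h₂]

theorem exists_quasiInverse_pair_of_target (f : U →ₗ[K] W) (g : V →ₗ[K] W) :
    ∃ (p h : W →ₗ[K] U) (q h' : W →ₗ[K] V), p ∘ₗ g = 0 ∧ q ∘ₗ f = 0 ∧ f ∘ₗ h = g ∘ₗ h' ∧
      f ∘ₗ (p + h) ∘ₗ f = f ∧ g ∘ₗ (q + h') ∘ₗ g = g := by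
  obtain ⟨u, hu, huS⟩ := exists_isIdempotent_range (range f ⊓ range g)
  obtain ⟨p, hpg, hpf⟩ := exists_comp_quasiInverse_eq f g u (fun x => (hu x).1) huS
  obtain ⟨q, hqf, hqg⟩ := exists_comp_quasiInverse_eq g f u (fun x => (hu x).2)
    fun x hx => huS x hx.symm
  obtain ⟨h, hh⟩ := exists_comp_eq_of_range_le_range f u
    (by rintro _ ⟨x, rfl⟩; exact (hu x).1)
  obtain ⟨h', hh'⟩ := exists_comp_eq_of_range_le_range g u
    (by rintro _ ⟨x, rfl⟩; exact (hu x).2)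
  refine ⟨p, h, q, h', hpg, hqf, hh.trans hh'.symm, ext fun x => ?_, ext fun x => ?_⟩
  · have := congr($hh (f x))
    simp only [comp_apply, add_apply, map_add] at this ⊢
    rw [this, hpf, sub_add_cancel]
  · have := congr($hh' (g x))
    simp only [comp_apply, add_apply, map_add] at this ⊢
    rw [this, hqg, sub_add_cancel]

end LinearMap

namespace AlgA

variable (k : Type) [Field k]

/-- The image in `A` of a generator of the path algebra. -/
noncomputable def gen (g : QGen) : AlgA k :=
  RingQuot.mkAlgHom k (ARel k) (FreeAlgebra.ι k g)

/-- The idempotent at a vertex. -/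
noncomputable def vert (i : Fin 3) : AlgA k := gen k (.e i)

/-- The class of an arrow. -/
noncomputable def arr (a : Fin 4) : AlgA k := gen k (.ar a)

theorem vert_mul_vert (i j : Fin 3) :
    vert k i * vert k j = if i = j then vert k i else 0 := by
  have := RingQuot.mkAlgHom_rel k (ARel.idem (k := k) i j)
  rw [map_mul] at this
  rw [vert, vert, gen, gen, this]
  split_ifs <;> simp

theorem sum_vert : vert k 0 + vert k 1 + vert k 2 = 1 := by
  have := RingQuot.mkAlgHom_rel k (ARel.sum (k := k))
  rwa [map_add, map_add, map_one] at this

theorem vert_src_mul_arr (a : Fin 4) : vert k (arrowSrc a) * arr k a = arr k a := by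
  have := RingQuot.mkAlgHom_rel k (ARel.src (k := k) a)
  rwa [map_mul] at this

theorem arr_mul_vert_tgt (a : Fin 4) : arr k a * vert k (arrowTgt a) = arr k a := by
  have := RingQuot.mkAlgHom_rel k (ARel.tgt (k := k) a)
  rwa [map_mul] at this

theorem arr_mul_arr (a b : Fin 4) : arr k a * arr k b = 0 := by
  have := RingQuot.mkAlgHom_rel k (ARel.radsq (k := k) a b)
  rwa [map_mul, map_zero] at this

theorem vert_mul_arr (i : Fin 3) (a : Fin 4) :
    vert k i * arr k a = if i = arrowSrc a then arr k a else 0 := by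
  rw [← vert_src_mul_arr, ← mul_assoc, vert_mul_vert]
  split_ifs with h
  · rw [h]
  · rw [zero_mul]

theorem arr_mul_vert (a : Fin 4) (i : Fin 3) :
    arr k a * vert k i = if i = arrowTgt a then arr k a else 0 := by
  rw [← arr_mul_vert_tgt, mul_assoc, vert_mul_vert]
  split_ifs with h₁ h₂ h₂
  · rfl
  · exact absurd h₁.symm h₂
  · exact absurd h₂.symm h₁
  · rw [mul_zero]

variable {k} in
@[elab_as_elim]
theorem induction_on {p : AlgA k → Prop} (x : AlgA k)
    (algebraMap : ∀ c, p (algebraMap k (AlgA k) c)) (vert : ∀ i, p (vert k i))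
    (arr : ∀ a, p (arr k a)) (add : ∀ x y, p x → p y → p (x + y))
    (mul : ∀ x y, p x → p y → p (x * y)) : p x := by
  obtain ⟨x, rfl⟩ := RingQuot.mkAlgHom_surjective k (ARel k) x
  induction x using FreeAlgebra.induction with
  | grade0 c => rw [AlgHom.commutes]; exact algebraMap c
  | grade1 g =>
    cases g with
    | e i => exact vert i
    | ar a => exact arr a
  | mul x y hx hy => rw [map_mul]; exact mul _ _ hx hy
  | add x y hx hy => rw [map_add]; exact add _ _ hx hy

theorem span_gen : Submodule.span k (Set.range (Sum.elim (vert k) (arr k))) = ⊤ := by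
  have hv (i) : vert k i ∈ Submodule.span k (Set.range (Sum.elim (vert k) (arr k))) :=
    Submodule.subset_span ⟨.inl i, rfl⟩
  have ha (a) : arr k a ∈ Submodule.span k (Set.range (Sum.elim (vert k) (arr k))) :=
    Submodule.subset_span ⟨.inr a, rfl⟩
  refine eq_top_iff.2 fun x _ => ?_
  induction x using induction_on with
  | algebraMap c =>
    rw [Algebra.algebraMap_eq_smul_one, ← sum_vert]
    exact Submodule.smul_mem _ _ (add_mem (add_mem (hv 0) (hv 1)) (hv 2))
  | vert i => exact hv i
  | arr a => exact ha a
  | add x y hx hy => exact add_mem (hx trivial) (hy trivial)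
  | mul x y hx hy =>
    refine Submodule.span_induction₂
      (p := fun x y _ _ =>
        x * y ∈ Submodule.span k (Set.range (Sum.elim (vert k) (arr k)))) ?_
      (fun _ _ => by rw [zero_mul]; exact zero_mem _)
      (fun _ _ => by rw [mul_zero]; exact zero_mem _)
      (fun _ _ _ _ _ _ h h' => by rw [add_mul]; exact add_mem h h')
      (fun _ _ _ _ _ _ h h' => by rw [mul_add]; exact add_mem h h')
      (fun c _ _ _ _ h => by rw [smul_mul_assoc]; exact Submodule.smul_mem _ c h)
      (fun c _ _ _ _ h => by rw [mul_smul_comm]; exact Submodule.smul_mem _ c h)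
      (hx trivial) (hy trivial)
    rintro _ _ ⟨i | a, rfl⟩ ⟨j | b, rfl⟩ <;>
      simp only [Sum.elim_inl, Sum.elim_inr, vert_mul_vert, vert_mul_arr, arr_mul_vert,
        arr_mul_arr] <;>
      (try split_ifs) <;> simp only [hv, ha, zero_mem]

instance : Module.Finite k (AlgA k) :=
  ⟨⟨(Set.finite_range (Sum.elim (vert k) (arr k))).toFinset,
    by rw [Set.Finite.coe_toFinset, span_gen]⟩⟩

/-- The representation of `A` by upper triangular matrices which is carried by an arrow. -/
noncomputable def arrowRep (b : Fin 4) : AlgA k →ₐ[k] Matrix (Fin 2) (Fin 2) k :=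
  RingQuot.liftAlgHom k
    ⟨FreeAlgebra.lift k (fun g => match g with
        | QGen.e j => !![if j = arrowSrc b then 1 else 0, 0; 0, if j = arrowTgt b then 1 else 0]
        | QGen.ar c => !![0, if c = b then 1 else 0; 0, 0]), by
      intro _x _y h
      induction h with
      | idem i j =>
        rw [apply_ite (FreeAlgebra.lift k _)]
        simp only [map_mul, FreeAlgebra.lift_ι_apply, map_zero, Matrix.mul_fin_two]
        ext u v
        fin_cases u <;> fin_cases v <;> split_ifs <;> simp_all
      | sum =>
        simp only [map_add, map_one, FreeAlgebra.lift_ι_apply]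
        ext i j
        fin_cases b <;> fin_cases i <;> fin_cases j <;> simp [arrowSrc, arrowTgt]
      | src a =>
        simp only [map_mul, FreeAlgebra.lift_ι_apply, Matrix.mul_fin_two]
        by_cases h : a = b <;> simp [h]
      | tgt a =>
        simp only [map_mul, FreeAlgebra.lift_ι_apply, Matrix.mul_fin_two]
        by_cases h : a = b <;> simp [h]
      | radsq a b =>
        ext u v
        fin_cases u <;> fin_cases v <;> simp [FreeAlgebra.lift_ι_apply, Matrix.mul_apply]⟩

theorem arrowRep_vert (b : Fin 4) (i : Fin 3) : arrowRep k b (vert k i) =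
    !![if i = arrowSrc b then 1 else 0, 0; 0, if i = arrowTgt b then 1 else 0] := by
  simp [arrowRep, vert, gen]

theorem arrowRep_arr (b c : Fin 4) : arrowRep k b (arr k c) =
    !![0, if c = b then 1 else 0; 0, 0] := by
  simp [arrowRep, arr, gen]

theorem simpleAlgHom_vert (i j : Fin 3) :
    simpleAlgHom k i (vert k j) = if j = i then 1 else 0 := by
  simp [simpleAlgHom, vert, gen]

theorem simpleAlgHom_arr (i : Fin 3) (a : Fin 4) : simpleAlgHom k i (arr k a) = 0 := by
  simp [simpleAlgHom, arr, gen]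

variable {k} in
theorem linearMap_ext {V : Type*} [AddCommGroup V] [Module k V] {f g : AlgA k →ₗ[k] V}
    (hv : ∀ i, f (vert k i) = g (vert k i)) (ha : ∀ a, f (arr k a) = g (arr k a)) : f = g :=
  LinearMap.ext_on_range (span_gen k) (by rintro (i | a); exacts [hv i, ha a])

/-- The coordinate function of an arrow. -/
noncomputable def coeff (b : Fin 4) : DualA k :=
  Matrix.entryLinearMap k k 0 1 ∘ₗ (arrowRep k b).toLinearMap

theorem coeff_arr (b c : Fin 4) : coeff k b (arr k c) = if c = b then 1 else 0 := by
  simp [coeff, arrowRep_arr]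

theorem coeff_mul (b : Fin 4) (x y : AlgA k) : coeff k b (x * y) =
    simpleAlgHom k (arrowSrc b) x * coeff k b y + coeff k b x * simpleAlgHom k (arrowTgt b) y := by
  have h₀ : Matrix.entryLinearMap k k 0 0 ∘ₗ (arrowRep k b).toLinearMap =
      (simpleAlgHom k (arrowSrc b)).toLinearMap := linearMap_ext
    (fun i => by simp [arrowRep_vert, simpleAlgHom_vert])
    (fun i => by simp [arrowRep_arr, simpleAlgHom_arr])
  have h₁ : Matrix.entryLinearMap k k 1 1 ∘ₗ (arrowRep k b).toLinearMap =
      (simpleAlgHom k (arrowTgt b)).toLinearMap := linearMap_ext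
    (fun i => by simp [arrowRep_vert, simpleAlgHom_vert])
    (fun i => by simp [arrowRep_arr, simpleAlgHom_arr])
  have h₀ : arrowRep k b x 0 0 = _ := congr($h₀ x)
  have h₁ : arrowRep k b y 1 1 = _ := congr($h₁ y)
  simp only [AlgHom.toLinearMap_apply] at h₀ h₁
  simp [coeff, Matrix.mul_apply, h₀, h₁]

theorem arr_mul (b : Fin 4) (x : AlgA k) :
    arr k b * x = simpleAlgHom k (arrowTgt b) x • arr k b := by
  have : LinearMap.mulLeft k (arr k b) =
      (simpleAlgHom k (arrowTgt b)).toLinearMap.smulRight (arr k b) := linearMap_ext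
    (fun i => by simp [arr_mul_vert, simpleAlgHom_vert])
    (fun a => by simp [arr_mul_arr, simpleAlgHom_arr])
  exact congr($this x)

theorem mul_arr (b : Fin 4) (x : AlgA k) :
    x * arr k b = simpleAlgHom k (arrowSrc b) x • arr k b := by
  have : LinearMap.mulRight k (arr k b) =
      (simpleAlgHom k (arrowSrc b)).toLinearMap.smulRight (arr k b) := linearMap_ext
    (fun i => by simp [vert_mul_arr, simpleAlgHom_vert])
    (fun a => by simp [arr_mul_arr, simpleAlgHom_arr])
  exact congr($this x)

section Factors

variable {Y : Type} [AddCommGroup Y] [Module (Aop k) Y]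

/-- A sum of endomorphisms which factor through `A ⊕ D(A)`. -/
def FactorsThroughMA (f : Y →ₗ[Aop k] Y) : Prop :=
  ∃ (J : Type) (_ : Fintype J) (s : J → Y →ₗ[Aop k] MA k) (t : J → MA k →ₗ[Aop k] Y),
    f = ∑ i, t i ∘ₗ s i

variable {k}

theorem FactorsThroughMA.add {f g : Y →ₗ[Aop k] Y} (hf : FactorsThroughMA k f)
    (hg : FactorsThroughMA k g) : FactorsThroughMA k (f + g) := by
  obtain ⟨J, _, s, t, rfl⟩ := hf
  obtain ⟨J', _, s', t', rfl⟩ := hg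
  exact ⟨J ⊕ J', inferInstance, Sum.elim s s', Sum.elim t t', by simp⟩

theorem FactorsThroughMA.inAdd (h : FactorsThroughMA k (LinearMap.id : Y →ₗ[Aop k] Y)) :
    InAdd k (MA k) Y := by
  obtain ⟨J, _, s, t, hst⟩ := h
  let e := Fintype.equivFin J
  refine ⟨Fintype.card J, LinearMap.pi fun i => s (e.symm i),
    ∑ i, t (e.symm i) ∘ₗ LinearMap.proj i, ?_⟩
  rw [hst]
  ext y
  simpa using e.symm.sum_comp fun j => t j (s j y)

end Factors

section Modules

variable {k}
variable {Y Z : Type} [AddCommGroup Y] [Module k Y] [Module (Aop k) Y] [IsScalarTower k (Aop k) Y]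
  [AddCommGroup Z] [Module k Z] [Module (Aop k) Z] [IsScalarTower k (Aop k) Z]

theorem exists_linearMap_eq (f : Y →ₗ[k] Z)
    (hv : ∀ i y, f (MulOpposite.op (vert k i) • y) = MulOpposite.op (vert k i) • f y)
    (ha : ∀ a y, f (MulOpposite.op (arr k a) • y) = MulOpposite.op (arr k a) • f y) :
    ∃ F : Y →ₗ[Aop k] Z, ∀ y, F y = f y := by
  refine ⟨⟨⟨f, map_add f⟩, fun x y => ?_⟩, fun _ => rfl⟩
  change f (x • y) = x • f y
  induction x using MulOpposite.rec' with | _ x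
  induction x using induction_on generalizing y with
  | algebraMap c =>
    rw [← MulOpposite.algebraMap_apply, algebraMap_smul, algebraMap_smul, map_smul]
  | vert i => exact hv i y
  | arr a => exact ha a y
  | add u v hu hv => rw [MulOpposite.op_add, add_smul, map_add, add_smul, hu, hv]
  | mul u v hu hv => rw [MulOpposite.op_mul, mul_smul, hv, hu, ← mul_smul]

instance : IsScalarTower k (Aop k) (DualA k) where
  smul_assoc c x φ := by
    change φ ∘ₗ LinearMap.mulLeft k (c • x.unop) = c • φ ∘ₗ LinearMap.mulLeft k x.unop
    ext y
    simp

theorem op_smul_dual_apply (x : AlgA k) (φ : DualA k) (y : AlgA k) :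
    (MulOpposite.op x • φ) y = φ (x * y) :=
  rfl

variable (Y) in
/-- The right action of an element of `A`. -/
noncomputable def act (x : AlgA k) : Module.End k Y :=
  Algebra.lsmul k k Y (MulOpposite.op x)

theorem act_apply (x : AlgA k) (y : Y) : act Y x y = MulOpposite.op x • y := rfl

theorem act_mul_act (x y : AlgA k) : act Y x * act Y y = act Y (y * x) := by
  rw [act, act, ← map_mul]
  rfl

theorem act_zero : act Y (0 : AlgA k) = 0 :=
  map_zero (Algebra.lsmul k k Y)

theorem act_vert_mul_act_vert (i j : Fin 3) :
    act Y (vert k i) * act Y (vert k j) = if i = j then act Y (vert k i) else 0 := by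
  rw [act_mul_act, vert_mul_vert]
  split_ifs with h₁ h₂ h₂
  · rw [h₁]
  · exact absurd h₁.symm h₂
  · exact absurd h₂.symm h₁
  · exact act_zero

theorem act_arr_mul_act_arr (a b : Fin 4) : act Y (arr k a) * act Y (arr k b) = 0 := by
  rw [act_mul_act, arr_mul_arr, act_zero]

theorem act_vert_mul_act_arr (i : Fin 3) (a : Fin 4) :
    act Y (vert k i) * act Y (arr k a) = if i = arrowTgt a then act Y (arr k a) else 0 := by
  rw [act_mul_act, arr_mul_vert, apply_ite (act Y), act_zero]

theorem act_arr_mul_act_vert (a : Fin 4) (i : Fin 3) :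
    act Y (arr k a) * act Y (vert k i) = if i = arrowSrc a then act Y (arr k a) else 0 := by
  rw [act_mul_act, vert_mul_arr, apply_ite (act Y), act_zero]

theorem sum_act_vert : act Y (vert k 0) + act Y (vert k 1) + act Y (vert k 2) = 1 := by
  simp only [act, ← map_add, ← MulOpposite.op_add, sum_vert, MulOpposite.op_one, map_one]

/-- The homomorphism to `D(A)` induced by a linear functional. -/
def toDual (ξ : Y →ₗ[k] k) : Y →ₗ[Aop k] DualA k where
  toFun y :=
    { toFun := fun x => ξ (MulOpposite.op x • y)
      map_add' := fun x x' => by rw [MulOpposite.op_add, add_smul, map_add]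
      map_smul' := fun c x => by
        rw [MulOpposite.op_smul, smul_assoc, map_smul, RingHom.id_apply] }
  map_add' y y' := LinearMap.ext fun x => by simp
  map_smul' x y := LinearMap.ext fun x' => by
    change ξ (MulOpposite.op x' • x • y) = ξ (MulOpposite.op (x.unop * x') • y)
    rw [MulOpposite.op_mul, MulOpposite.op_unop, mul_smul]

theorem toDual_apply (ξ : Y →ₗ[k] k) (y : Y) (x : AlgA k) :
    toDual ξ y x = ξ (MulOpposite.op x • y) := rfl

theorem exists_linearMap_dual (j : Fin 3) (y : Fin 4 → Y) (z : Y)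
    (hv : ∀ i a, MulOpposite.op (vert k i) • y a = if i = arrowSrc a then y a else 0)
    (ha : ∀ b a, MulOpposite.op (arr k b) • y a = if b = a ∧ arrowTgt a = j then z else 0)
    (hvz : ∀ i, MulOpposite.op (vert k i) • z = if i = j then z else 0)
    (haz : ∀ b, MulOpposite.op (arr k b) • z = 0) :
    ∃ F : DualA k →ₗ[Aop k] Y, ∀ φ, F φ = ∑ a, φ (arr k a) • y a + φ (vert k j) • z := by
  have hc (c : k) (x : AlgA k) (y : Y) : MulOpposite.op x • c • y = c • MulOpposite.op x • y :=
    (act Y x).map_smul c y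
  let f : DualA k →ₗ[k] Y := ∑ a, (LinearMap.applyₗ (arr k a)).smulRight (y a) +
    (LinearMap.applyₗ (vert k j)).smulRight z
  have hf (φ) : f φ = ∑ a, φ (arr k a) • y a + φ (vert k j) • z := by simp [f]
  obtain ⟨F, hF⟩ := exists_linearMap_eq f (fun i φ => by
      simp only [hf, op_smul_dual_apply, vert_mul_arr, vert_mul_vert, smul_add, Finset.smul_sum, hc,
        hv, hvz]
      congr 1
      · refine Finset.sum_congr rfl fun a _ => ?_
        split_ifs <;> simp
      · split_ifs with h <;> simp [h])
    (fun b φ => by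
      simp only [hf, op_smul_dual_apply, arr_mul_arr, arr_mul_vert, smul_add, Finset.smul_sum, hc,
        ha, haz]
      simp only [map_zero, zero_smul, Finset.sum_const_zero, zero_add]
      rw [Finset.sum_eq_single b (fun a _ hab => by simp [hab.symm]) (by simp)]
      by_cases h : arrowTgt b = j
      · simp [h]
      · simp [h, Ne.symm h])
  exact ⟨F, fun φ => (hF φ).trans (hf φ)⟩

theorem exists_linearMap_regular (j : Fin 3) (p : Fin 4 → Y →ₗ[k] k) (u : Y →ₗ[k] k)
    (hv : ∀ a i, p a ∘ₗ act Y (vert k i) = if i = arrowTgt a then p a else 0)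
    (ha : ∀ a b, p a ∘ₗ act Y (arr k b) = if b = a ∧ arrowSrc a = j then u else 0)
    (hvu : ∀ i, u ∘ₗ act Y (vert k i) = if i = j then u else 0)
    (hau : ∀ b, u ∘ₗ act Y (arr k b) = 0) :
    ∃ F : Y →ₗ[Aop k] AlgA k, ∀ y, F y = u y • vert k j + ∑ a, p a y • arr k a := by
  have hx (x : AlgA k) (c : k) (z : AlgA k) : MulOpposite.op x • c • z = c • (z * x) :=
    smul_mul_assoc c z x
  let f : Y →ₗ[k] AlgA k := u.smulRight (vert k j) + ∑ a, (p a).smulRight (arr k a)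
  have hf (y) : f y = u y • vert k j + ∑ a, p a y • arr k a := by simp [f]
  obtain ⟨F, hF⟩ := exists_linearMap_eq f (fun i y => by
      have hv' (a) : p a (MulOpposite.op (vert k i) • y) = _ := congr($(hv a i) y)
      have hvu' : u (MulOpposite.op (vert k i) • y) = _ := congr($(hvu i) y)
      simp only [hf, smul_add, Finset.smul_sum, hx, vert_mul_vert, arr_mul_vert, hv', hvu']
      congr 1
      · by_cases h : i = j
        · simp [h]
        · simp [h, Ne.symm h]
      · refine Finset.sum_congr rfl fun a _ => ?_
        split_ifs <;> simp)
    (fun b y => by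
      have ha' (a) : p a (MulOpposite.op (arr k b) • y) = _ := congr($(ha a b) y)
      have hau' : u (MulOpposite.op (arr k b) • y) = _ := congr($(hau b) y)
      simp only [hf, smul_add, Finset.smul_sum, hx, vert_mul_arr, arr_mul_arr, ha', hau']
      rw [Finset.sum_eq_single b (fun a _ hab => by simp [hab.symm]) (by simp)]
      by_cases h : arrowSrc b = j
      · simp [h]
      · simp [h, Ne.symm h])
  exact ⟨F, fun y => (hF y).trans (hf y)⟩

/-- The linear maps which vanish on `Y e_l` for `l ≠ i` and take values in `Y e_j`. -/
def IsBlock (i j : Fin 3) (f : Module.End k Y) : Prop :=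
  act Y (vert k j) * f = f ∧ f * act Y (vert k i) = f

namespace IsBlock

variable {i j l : Fin 3} {f g : Module.End k Y}

theorem vert_mul (hf : IsBlock i j f) (l : Fin 3) :
    act Y (vert k l) * f = if l = j then f else 0 := by
  conv_lhs => rw [← hf.1, ← mul_assoc, act_vert_mul_act_vert]
  split_ifs with h
  · rw [h, hf.1]
  · rw [zero_mul]

theorem mul_vert (hf : IsBlock i j f) (l : Fin 3) :
    f * act Y (vert k l) = if l = i then f else 0 := by
  conv_lhs => rw [← hf.2, mul_assoc, act_vert_mul_act_vert]
  split_ifs with h₁ h₂ h₂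
  · exact hf.2
  · exact absurd h₁.symm h₂
  · exact absurd h₂.symm h₁
  · rw [mul_zero]

theorem arr_mul_eq_zero (hf : IsBlock i j f) {a : Fin 4} (ha : j ≠ arrowSrc a) :
    act Y (arr k a) * f = 0 := by
  rw [← hf.1, ← mul_assoc, act_arr_mul_act_vert, if_neg ha, zero_mul]

theorem mul_arr_eq_zero (hf : IsBlock i j f) {a : Fin 4} (ha : i ≠ arrowTgt a) :
    f * act Y (arr k a) = 0 := by
  rw [← hf.2, mul_assoc, act_vert_mul_act_arr, if_neg ha, mul_zero]

theorem mul (hf : IsBlock i j f) (hg : IsBlock l i g) : IsBlock l j (f * g) :=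
  ⟨by rw [← mul_assoc, hf.1], by rw [mul_assoc, hg.2]⟩

theorem add (hf : IsBlock i j f) (hg : IsBlock i j g) : IsBlock i j (f + g) :=
  ⟨by rw [mul_add, hf.1, hg.1], by rw [add_mul, hf.2, hg.2]⟩

theorem sub (hf : IsBlock i j f) (hg : IsBlock i j g) : IsBlock i j (f - g) :=
  ⟨by rw [mul_sub, hf.1, hg.1], by rw [sub_mul, hf.2, hg.2]⟩

theorem act_vert (i : Fin 3) : IsBlock i i (act Y (vert k i)) := by
  constructor <;> rw [act_vert_mul_act_vert, if_pos rfl]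

theorem act_arr (a : Fin 4) : IsBlock (arrowSrc a) (arrowTgt a) (act Y (arr k a)) :=
  ⟨by rw [act_vert_mul_act_arr, if_pos rfl], by rw [act_arr_mul_act_vert, if_pos rfl]⟩

theorem corner (i j : Fin 3) (f : Module.End k Y) :
    IsBlock i j (act Y (vert k j) * f * act Y (vert k i)) :=
  ⟨by rw [← mul_assoc, ← mul_assoc, act_vert_mul_act_vert, if_pos rfl],
    by rw [mul_assoc, act_vert_mul_act_vert, if_pos rfl]⟩

end IsBlock

/-- If `Ext¹(A ⊕ D(A), Y) = 0`, then the cocycles with values in the socle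
of `Y` built from a pair of arrows with a common source are coboundaries. -/
theorem exists_map_of_subsingleton_ext (hY : Subsingleton (ExtA k (MA k) Y 1)) {b b' : Fin 4}
    (hb : arrowSrc b = arrowSrc b') {x : Y} (hv : act Y (vert k (arrowTgt b')) x = x)
    (ha : ∀ a, act Y (arr k a) x = 0) :
    ∃ σ : DualA k →+ Y, ∀ (y : AlgA k) (φ : DualA k),
      σ (MulOpposite.op y • φ) = act Y y (σ φ) + (φ (arr k b) * coeff k b' y) • x := by
  have hx (y : AlgA k) : act Y y x = simpleAlgHom k (arrowTgt b') y • x := by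
    let F : AlgA k →ₗ[k] Y :=
      { toFun := fun y => act Y y x
        map_add' := fun y z => by simp only [act_apply, MulOpposite.op_add, add_smul]
        map_smul' := fun c y => by
          simp only [act_apply, MulOpposite.op_smul, smul_assoc, RingHom.id_apply] }
    have : F = (simpleAlgHom k (arrowTgt b')).toLinearMap.smulRight x := linearMap_ext
      (fun i => by
        change act Y (vert k i) x = simpleAlgHom k (arrowTgt b') (vert k i) • x
        rw [simpleAlgHom_vert, ← hv, ← Module.End.mul_apply, act_vert_mul_act_vert]
        split_ifs with h
        · rw [h, one_smul]
        · rw [zero_smul, LinearMap.zero_apply])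
      (fun a => by
        change act Y (arr k a) x = simpleAlgHom k (arrowTgt b') (arr k a) • x
        rw [ha, simpleAlgHom_arr, zero_smul])
    exact congr($this y)
  let c : Aop k →+ MA k →+ Y := AddMonoidHom.mk' (fun r => AddMonoidHom.mk'
    (fun z => (z.2 (arr k b) * coeff k b' r.unop) • x)
      (fun z z' => by simp only [Prod.snd_add, LinearMap.add_apply, add_mul, add_smul]))
    (fun r r' => AddMonoidHom.ext fun z => by simp [mul_add, add_smul])
  have hc (r : Aop k) (z : MA k) : c r z = (z.2 (arr k b) * coeff k b' r.unop) • x := rfl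
  obtain ⟨σ, hσ⟩ := exists_coboundary_of_subsingleton_ext hY c fun r s z => by
    have h₁ : (s • z).2 (arr k b) = simpleAlgHom k (arrowSrc b') s.unop * z.2 (arr k b) := by
      change z.2 (s.unop * arr k b) = _
      rw [mul_arr, map_smul, hb, smul_eq_mul]
    have h₂ (t : k) : r • t • x = (t * simpleAlgHom k (arrowTgt b') r.unop) • x := by
      rw [mul_smul, ← hx, ← map_smul]
      rfl
    rw [hc, hc, hc, h₁, h₂, MulOpposite.unop_mul, coeff_mul, ← add_smul]
    congr 1
    ring
  refine ⟨σ.comp (AddMonoidHom.inr (AlgA k) (DualA k)), fun y φ => ?_⟩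
  have := hσ (MulOpposite.op y) (0, φ)
  rw [hc] at this
  simpa [act_apply] using this

theorem op_arr_smul_coeff (a b : Fin 4) :
    MulOpposite.op (arr k a) • coeff k b =
      if a = b then (simpleAlgHom k (arrowTgt b)).toLinearMap else 0 :=
  LinearMap.ext fun y => by
    rw [op_smul_dual_apply, arr_mul, map_smul, coeff_arr]
    split_ifs with h <;> simp [h]

theorem exists_act_arr_eq (hY : Subsingleton (ExtA k (MA k) Y 1)) {b b' : Fin 4} (hbb : b ≠ b')
    (hb : arrowSrc b = arrowSrc b') {x : Y} (hv : act Y (vert k (arrowTgt b')) x = x)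
    (ha : ∀ a, act Y (arr k a) x = 0) : ∃ y, act Y (arr k b') y = x := by
  obtain ⟨σ, hσ⟩ := exists_map_of_subsingleton_ext hY hb hv ha
  have := hσ (arr k b') (coeff k b)
  rw [op_arr_smul_coeff, if_neg hbb.symm, map_zero, coeff_arr, coeff_arr, if_pos rfl, if_pos rfl,
    mul_one, one_smul] at this
  exact ⟨-σ (coeff k b), by rw [map_neg]; exact neg_eq_of_add_eq_zero_right this.symm⟩

theorem exists_act_arr_add_act_arr_eq (hY : Subsingleton (ExtA k (MA k) Y 1)) {a b : Fin 4}
    (hab : a ≠ b) (ht : arrowTgt a = arrowTgt b) {x : Y}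
    (hv : act Y (vert k (arrowTgt b)) x = x) (hx : ∀ c, act Y (arr k c) x = 0) :
    ∃ y z, act Y (arr k a) y + act Y (arr k b) z = x := by
  obtain ⟨σ, hσ⟩ := exists_map_of_subsingleton_ext hY rfl hv hx
  have h₁ := hσ (arr k a) (coeff k a)
  have h₂ := hσ (arr k b) (coeff k b)
  rw [op_arr_smul_coeff, if_pos rfl, coeff_arr, coeff_arr, if_neg hab.symm, zero_mul, zero_smul,
    add_zero, ht] at h₁
  rw [op_arr_smul_coeff, if_pos rfl, coeff_arr, if_pos rfl, mul_one, one_smul, h₁] at h₂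
  exact ⟨σ (coeff k a), -σ (coeff k b), by rw [h₂, map_neg]; abel⟩

theorem mul_eq_zero_of_source_eq (hY : Subsingleton (ExtA k (MA k) Y 1)) {b b' : Fin 4}
    (hbb : b ≠ b') (hb : arrowSrc b = arrowSrc b') {f g : Module.End k Y}
    (hv : act Y (vert k (arrowTgt b')) * f = f)
    (ha : ∀ a, act Y (arr k a) * f = 0) (hg : g * act Y (arr k b') = 0) : g * f = 0 :=
  LinearMap.ext fun x => by
    obtain ⟨y, hy⟩ := exists_act_arr_eq hY hbb hb (x := f x) congr($hv x) fun a => congr($(ha a) x)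
    rw [Module.End.mul_apply, ← hy]
    exact congr($hg y)

theorem mul_eq_zero_of_target_eq (hY : Subsingleton (ExtA k (MA k) Y 1)) {a b : Fin 4}
    (hab : a ≠ b) (ht : arrowTgt a = arrowTgt b) {f g : Module.End k Y}
    (hv : act Y (vert k (arrowTgt b)) * f = f) (hf : ∀ c, act Y (arr k c) * f = 0)
    (hga : g * act Y (arr k a) = 0) (hgb : g * act Y (arr k b) = 0) : g * f = 0 :=
  LinearMap.ext fun x => by
    obtain ⟨y, z, hyz⟩ := exists_act_arr_add_act_arr_eq hY hab ht (x := f x) congr($hv x)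
      fun c => congr($(hf c) x)
    have h₁ : g (act Y (arr k a) y) = 0 := congr($hga y)
    have h₂ : g (act Y (arr k b) z) = 0 := congr($hgb z)
    rw [Module.End.mul_apply, ← hyz, map_add, h₁, h₂, add_zero, LinearMap.zero_apply]

variable (k Y) in
/-- The arrows `β` and `γ`, which share their source, have quasi-inverses `p + h` and `q + h'`
whose summands are compatible with both arrows. -/
theorem exists_blocks_of_source : ∃ p h q h' : Module.End k Y,
    (IsBlock 0 1 p ∧ IsBlock 0 1 h ∧ IsBlock 2 1 q ∧ IsBlock 2 1 h') ∧
    act Y (arr k 2) * h = 0 ∧ act Y (arr k 1) * h' = 0 ∧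
    p * act Y (arr k 1) = q * act Y (arr k 2) ∧
    act Y (arr k 1) * (p + h) * act Y (arr k 1) = act Y (arr k 1) ∧
    act Y (arr k 2) * (q + h') * act Y (arr k 2) = act Y (arr k 2) := by
  obtain ⟨p, h, q, h', h₁, h₂, h₃, h₄, h₅⟩ :=
    LinearMap.exists_quasiInverse_pair_of_source (act Y (arr k 1)) (act Y (arr k 2))
  have l₁ : act Y (arr k 1) * act Y (vert k 1) = act Y (arr k 1) := (IsBlock.act_arr 1).2
  have l₂ : act Y (arr k 2) * act Y (vert k 1) = act Y (arr k 2) := (IsBlock.act_arr 2).2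
  have r₁ : act Y (vert k 0) * act Y (arr k 1) = act Y (arr k 1) := (IsBlock.act_arr 1).1
  have r₂ : act Y (vert k 2) * act Y (arr k 2) = act Y (arr k 2) := (IsBlock.act_arr 2).1
  simp only [← Module.End.mul_eq_comp] at h₁ h₂ h₃ h₄ h₅
  refine ⟨_, _, _, _, ⟨.corner 0 1 p, .corner 0 1 h, .corner 2 1 q, .corner 2 1 h'⟩,
    ?_, ?_, ?_, ?_, ?_⟩
  · rw [← mul_assoc, ← mul_assoc, l₂, h₁, zero_mul]
  · rw [← mul_assoc, ← mul_assoc, l₁, h₂, zero_mul]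
  · rw [mul_assoc, mul_assoc, r₁, mul_assoc, mul_assoc, r₂, h₃]
  · rw [← add_mul, ← mul_add, ← mul_assoc, ← mul_assoc, l₁, mul_assoc _ _ (act Y (arr k 1)), r₁,
      mul_assoc, h₄]
  · rw [← add_mul, ← mul_add, ← mul_assoc, ← mul_assoc, l₂, mul_assoc _ _ (act Y (arr k 2)), r₂,
      mul_assoc, h₅]

variable [Module.Finite k Y]

theorem exists_factors_dual (j : Fin 3) (h : Fin 4 → Module.End k Y) (l : Module.End k Y)
    (hv : ∀ i a, act Y (vert k i) * h a = if i = arrowSrc a then h a else 0)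
    (ha : ∀ b a, act Y (arr k b) * h a = if b = a ∧ arrowTgt a = j then l else 0)
    (hvl : ∀ i, act Y (vert k i) * l = if i = j then l else 0)
    (hal : ∀ b, act Y (arr k b) * l = 0) :
    ∃ F : Y →ₗ[Aop k] Y, FactorsThroughMA k F ∧
      ∀ y, F y = (∑ a, h a * act Y (arr k a) + l * act Y (vert k j)) y := by
  let b := Module.finBasis k Y
  have key (i) := exists_linearMap_dual j (fun a => h a (b i)) (l (b i))
    (fun i' a => (congr($(hv i' a) (b i)) : _ = _).trans (by split_ifs <;> rfl))
    (fun c a => (congr($(ha c a) (b i)) : _ = _).trans (by split_ifs <;> rfl))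
    (fun i' => (congr($(hvl i') (b i)) : _ = _).trans (by split_ifs <;> rfl))
    (fun c => congr($(hal c) (b i)))
  choose G hG using key
  refine ⟨∑ i, (G i ∘ₗ LinearMap.snd _ _ _) ∘ₗ (LinearMap.inr _ _ _ ∘ₗ toDual (b.coord i)),
    ⟨_, inferInstance, fun i => LinearMap.inr _ _ _ ∘ₗ toDual (b.coord i),
      fun i => G i ∘ₗ LinearMap.snd _ _ _, rfl⟩, fun y => ?_⟩
  have hb (f : Module.End k Y) (z : Y) : f z = ∑ i, b.repr z i • f (b i) := by
    conv_lhs => rw [← b.sum_repr z]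
    simp only [map_sum, map_smul]
  simp only [LinearMap.sum_apply, LinearMap.comp_apply, LinearMap.inr_apply, LinearMap.snd_apply,
    hG, toDual_apply, LinearMap.add_apply, Module.End.mul_apply, Module.Basis.coord_apply,
    Finset.sum_add_distrib]
  rw [Finset.sum_comm, hb l]
  congr 1
  exact Finset.sum_congr rfl fun a _ => (hb _ _).symm

theorem exists_factors_regular (j : Fin 3) (h : Fin 4 → Module.End k Y) (l : Module.End k Y)
    (hv : ∀ a i, h a * act Y (vert k i) = if i = arrowTgt a then h a else 0)
    (ha : ∀ a b, h a * act Y (arr k b) = if b = a ∧ arrowSrc a = j then l else 0)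
    (hvl : ∀ i, l * act Y (vert k i) = if i = j then l else 0)
    (hal : ∀ b, l * act Y (arr k b) = 0) :
    ∃ F : Y →ₗ[Aop k] Y, FactorsThroughMA k F ∧
      ∀ y, F y = (∑ a, act Y (arr k a) * h a + act Y (vert k j) * l) y := by
  let b := Module.finBasis k Y
  have key (i) := exists_linearMap_regular j (fun a => b.coord i ∘ₗ h a) (b.coord i ∘ₗ l)
    (fun a i' => (congr(b.coord i ∘ₗ $(hv a i')) : _ = _).trans (by split_ifs <;> simp))
    (fun a c => (congr(b.coord i ∘ₗ $(ha a c)) : _ = _).trans (by split_ifs <;> simp))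
    (fun i' => (congr(b.coord i ∘ₗ $(hvl i')) : _ = _).trans (by split_ifs <;> simp))
    (fun c => (congr(b.coord i ∘ₗ $(hal c)) : _ = _).trans (by simp))
  choose G hG using key
  have hr (z : Y) : ∃ F : AlgA k →ₗ[Aop k] Y, ∀ x, F x = MulOpposite.op x • z :=
    ⟨⟨⟨fun x => MulOpposite.op x • z, fun x y => by rw [MulOpposite.op_add, add_smul]⟩,
      fun x y => by
        change MulOpposite.op (y * x.unop) • z = x • MulOpposite.op y • z
        rw [MulOpposite.op_mul, MulOpposite.op_unop, mul_smul]⟩, fun _ => rfl⟩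
  choose R hR using hr
  refine ⟨∑ i, (R (b i) ∘ₗ LinearMap.fst _ _ _) ∘ₗ (LinearMap.inl _ _ _ ∘ₗ G i),
    ⟨_, inferInstance, fun i => LinearMap.inl _ _ _ ∘ₗ G i,
      fun i => R (b i) ∘ₗ LinearMap.fst _ _ _, rfl⟩, fun y => ?_⟩
  have hb (x : AlgA k) (z : Y) : act Y x z = ∑ i, b.repr z i • MulOpposite.op x • b i := by
    conv_lhs => rw [← b.sum_repr z]
    simp only [map_sum, map_smul, act_apply]
  simp only [LinearMap.sum_apply, LinearMap.comp_apply, LinearMap.inl_apply, LinearMap.fst_apply,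
    hG, hR, LinearMap.add_apply, Module.End.mul_apply, Module.Basis.coord_apply,
    MulOpposite.op_add, MulOpposite.op_smul, Finset.op_sum, add_smul, Finset.sum_smul, smul_assoc,
    Finset.sum_add_distrib]
  rw [Finset.sum_comm, hb (vert k j), add_comm]
  congr 1
  exact Finset.sum_congr rfl fun a _ => (hb _ _).symm

theorem exists_factors_dual_zero {h : Module.End k Y} (hh : IsBlock 0 1 h)
    (h₀ : act Y (arr k 2) * h = 0) :
    ∃ F : Y →ₗ[Aop k] Y, FactorsThroughMA k F ∧
      ∀ y, F y = (h * act Y (arr k 1) + act Y (arr k 1) * h) y := by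
  have hl : IsBlock 0 0 (act Y (arr k 1) * h) := (IsBlock.act_arr 1).mul hh
  obtain ⟨F, hF, hF'⟩ := exists_factors_dual 0 ![0, h, 0, 0] (act Y (arr k 1) * h)
    (fun i a => by fin_cases a <;> fin_cases i <;> simp [hh.vert_mul, arrowSrc])
    (fun b a => by
      fin_cases a <;> fin_cases b <;>
        simp [h₀, arrowTgt, hh.arr_mul_eq_zero (show (1 : Fin 3) ≠ arrowSrc 0 by decide),
          hh.arr_mul_eq_zero (show (1 : Fin 3) ≠ arrowSrc 3 by decide)])
    hl.vert_mul
    (fun b => by rw [← mul_assoc, act_arr_mul_act_arr, zero_mul])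
  exact ⟨F, hF, fun y => by rw [hF', hl.2]; simp [Fin.sum_univ_succ]⟩

theorem exists_factors_dual_two {h : Module.End k Y} (hh : IsBlock 2 1 h)
    (h₀ : act Y (arr k 1) * h = 0) :
    ∃ F : Y →ₗ[Aop k] Y, FactorsThroughMA k F ∧
      ∀ y, F y = (h * act Y (arr k 2) + act Y (arr k 2) * h) y := by
  have hl : IsBlock 2 2 (act Y (arr k 2) * h) := (IsBlock.act_arr 2).mul hh
  obtain ⟨F, hF, hF'⟩ := exists_factors_dual 2 ![0, 0, h, 0] (act Y (arr k 2) * h)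
    (fun i a => by fin_cases a <;> fin_cases i <;> simp [hh.vert_mul, arrowSrc])
    (fun b a => by
      fin_cases a <;> fin_cases b <;>
        simp [h₀, arrowTgt, hh.arr_mul_eq_zero (show (1 : Fin 3) ≠ arrowSrc 0 by decide),
          hh.arr_mul_eq_zero (show (1 : Fin 3) ≠ arrowSrc 3 by decide)])
    hl.vert_mul
    (fun b => by rw [← mul_assoc, act_arr_mul_act_arr, zero_mul])
  exact ⟨F, hF, fun y => by rw [hF', hl.2]; simp [Fin.sum_univ_succ]⟩

theorem exists_factors_dual_one {h h' : Module.End k Y} (hh : IsBlock 1 0 h) (hh' : IsBlock 1 2 h')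
    (h₀ : act Y (arr k 0) * h = act Y (arr k 3) * h') :
    ∃ F : Y →ₗ[Aop k] Y, FactorsThroughMA k F ∧
      ∀ y, F y = (h * act Y (arr k 0) + h' * act Y (arr k 3) + act Y (arr k 0) * h) y := by
  have hl : IsBlock 1 1 (act Y (arr k 0) * h) := (IsBlock.act_arr 0).mul hh
  obtain ⟨F, hF, hF'⟩ := exists_factors_dual 1 ![h, 0, 0, h'] (act Y (arr k 0) * h)
    (fun i a => by fin_cases a <;> fin_cases i <;> simp [hh.vert_mul, hh'.vert_mul, arrowSrc])
    (fun b a => by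
      fin_cases a <;> fin_cases b <;>
        simp [h₀, arrowTgt, hh.arr_mul_eq_zero (show (0 : Fin 3) ≠ arrowSrc 1 by decide),
          hh.arr_mul_eq_zero (show (0 : Fin 3) ≠ arrowSrc 2 by decide),
          hh.arr_mul_eq_zero (show (0 : Fin 3) ≠ arrowSrc 3 by decide),
          hh'.arr_mul_eq_zero (show (2 : Fin 3) ≠ arrowSrc 0 by decide),
          hh'.arr_mul_eq_zero (show (2 : Fin 3) ≠ arrowSrc 1 by decide),
          hh'.arr_mul_eq_zero (show (2 : Fin 3) ≠ arrowSrc 2 by decide)])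
    hl.vert_mul
    (fun b => by rw [← mul_assoc, act_arr_mul_act_arr, zero_mul])
  exact ⟨F, hF, fun y => by rw [hF', hl.2]; simp [Fin.sum_univ_succ]⟩

theorem exists_factors_regular_zero {p : Module.End k Y} (hp : IsBlock 1 0 p)
    (h₀ : p * act Y (arr k 3) = 0) :
    ∃ F : Y →ₗ[Aop k] Y, FactorsThroughMA k F ∧
      ∀ y, F y = (act Y (arr k 0) * p + p * act Y (arr k 0)) y := by
  have hl : IsBlock 0 0 (p * act Y (arr k 0)) := hp.mul (IsBlock.act_arr 0)
  obtain ⟨F, hF, hF'⟩ := exists_factors_regular 0 ![p, 0, 0, 0] (p * act Y (arr k 0))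
    (fun a i => by fin_cases a <;> fin_cases i <;> simp [hp.mul_vert, arrowTgt])
    (fun a b => by
      fin_cases a <;> fin_cases b <;>
        simp [h₀, arrowSrc, hp.mul_arr_eq_zero (show (1 : Fin 3) ≠ arrowTgt 1 by decide),
          hp.mul_arr_eq_zero (show (1 : Fin 3) ≠ arrowTgt 2 by decide)])
    hl.mul_vert
    (fun b => by rw [mul_assoc, act_arr_mul_act_arr, mul_zero])
  exact ⟨F, hF, fun y => by rw [hF', hl.1]; simp [Fin.sum_univ_succ]⟩

theorem exists_factors_regular_two {p : Module.End k Y} (hp : IsBlock 1 2 p)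
    (h₀ : p * act Y (arr k 0) = 0) :
    ∃ F : Y →ₗ[Aop k] Y, FactorsThroughMA k F ∧
      ∀ y, F y = (act Y (arr k 3) * p + p * act Y (arr k 3)) y := by
  have hl : IsBlock 2 2 (p * act Y (arr k 3)) := hp.mul (IsBlock.act_arr 3)
  obtain ⟨F, hF, hF'⟩ := exists_factors_regular 2 ![0, 0, 0, p] (p * act Y (arr k 3))
    (fun a i => by fin_cases a <;> fin_cases i <;> simp [hp.mul_vert, arrowTgt])
    (fun a b => by
      fin_cases a <;> fin_cases b <;>
        simp [h₀, arrowSrc, hp.mul_arr_eq_zero (show (1 : Fin 3) ≠ arrowTgt 1 by decide),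
          hp.mul_arr_eq_zero (show (1 : Fin 3) ≠ arrowTgt 2 by decide)])
    hl.mul_vert
    (fun b => by rw [mul_assoc, act_arr_mul_act_arr, mul_zero])
  exact ⟨F, hF, fun y => by rw [hF', hl.1]; simp [Fin.sum_univ_succ]⟩

theorem exists_factors_regular_one {p q : Module.End k Y} (hp : IsBlock 0 1 p) (hq : IsBlock 2 1 q)
    (h₀ : p * act Y (arr k 1) = q * act Y (arr k 2)) :
    ∃ F : Y →ₗ[Aop k] Y, FactorsThroughMA k F ∧
      ∀ y, F y = (act Y (arr k 1) * p + act Y (arr k 2) * q + p * act Y (arr k 1)) y := by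
  have hl : IsBlock 1 1 (p * act Y (arr k 1)) := hp.mul (IsBlock.act_arr 1)
  obtain ⟨F, hF, hF'⟩ := exists_factors_regular 1 ![0, p, q, 0] (p * act Y (arr k 1))
    (fun a i => by fin_cases a <;> fin_cases i <;> simp [hp.mul_vert, hq.mul_vert, arrowTgt])
    (fun a b => by
      fin_cases a <;> fin_cases b <;>
        simp [h₀, arrowSrc, hp.mul_arr_eq_zero (show (0 : Fin 3) ≠ arrowTgt 0 by decide),
          hp.mul_arr_eq_zero (show (0 : Fin 3) ≠ arrowTgt 2 by decide),
          hp.mul_arr_eq_zero (show (0 : Fin 3) ≠ arrowTgt 3 by decide),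
          hq.mul_arr_eq_zero (show (2 : Fin 3) ≠ arrowTgt 0 by decide),
          hq.mul_arr_eq_zero (show (2 : Fin 3) ≠ arrowTgt 1 by decide),
          hq.mul_arr_eq_zero (show (2 : Fin 3) ≠ arrowTgt 3 by decide)])
    hl.mul_vert
    (fun b => by rw [mul_assoc, act_arr_mul_act_arr, mul_zero])
  exact ⟨F, hF, fun y => by rw [hF', hl.1]; simp [Fin.sum_univ_succ]⟩

/-- A module with `Ext¹(A ⊕ D(A), Y) = 0` is a summand of a power of `A ⊕ D(A)`. -/
theorem inAdd_of_subsingleton_ext (hY : Subsingleton (ExtA k (MA k) Y 1)) :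
    InAdd k (MA k) Y := by
  obtain ⟨p, h, q, h', ⟨bp, bh, bq, bh'⟩, h₁, h₂, h₃, h₄, h₅⟩ := exists_blocks_of_source k Y
  obtain ⟨P, H, Q, H', H₁, H₂, H₃, H₄, H₅⟩ :=
    LinearMap.exists_quasiInverse_pair_of_target (act Y (arr k 0)) (act Y (arr k 3))
  simp only [← Module.End.mul_eq_comp] at H₁ H₂ H₃ H₄ H₅
  obtain ⟨F₁, hF₁, e₁⟩ := exists_factors_regular_one bp bq h₃
  obtain ⟨F₂, hF₂, e₂⟩ := exists_factors_dual_zero bh h₁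
  obtain ⟨F₃, hF₃, e₃⟩ := exists_factors_dual_two bh' h₂
  have v (i : Fin 3) : IsBlock i i (act Y (vert k i)) := IsBlock.act_vert i
  have b₀ : IsBlock 0 1 (act Y (arr k 0)) := .act_arr 0
  have b₁ : IsBlock 1 0 (act Y (arr k 1)) := .act_arr 1
  have b₂ : IsBlock 1 2 (act Y (arr k 2)) := .act_arr 2
  have b₃ : IsBlock 2 1 (act Y (arr k 3)) := .act_arr 3
  have hrad (a b : Fin 4) := act_arr_mul_act_arr (Y := Y) (k := k) a b
  have hrad' (a b : Fin 4) (f : Module.End k Y) : act Y (arr k a) * (act Y (arr k b) * f) = 0 := by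
    rw [← mul_assoc, hrad, zero_mul]
  obtain ⟨ε₀, hε₀⟩ : ∃ ε, ε = act Y (vert k 0) - act Y (arr k 1) * (p + h) := ⟨_, rfl⟩
  obtain ⟨ε₂, hε₂⟩ : ∃ ε, ε = act Y (vert k 2) - act Y (arr k 2) * (q + h') := ⟨_, rfl⟩
  obtain ⟨ε₁, hε₁⟩ : ∃ ε, ε = act Y (vert k 1) -
    (p * act Y (arr k 1) + h * act Y (arr k 1) + h' * act Y (arr k 2)) := ⟨_, rfl⟩
  have c₀ : IsBlock 0 0 ε₀ := hε₀ ▸ (v 0).sub (b₁.mul (bp.add bh))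
  have c₂ : IsBlock 2 2 ε₂ := hε₂ ▸ (v 2).sub (b₂.mul (bq.add bh'))
  have c₁ : IsBlock 1 1 ε₁ := hε₁ ▸ (v 1).sub (((bp.mul b₁).add (bh.mul b₁)).add (bh'.mul b₂))
  have s₀ : act Y (arr k 0) * ε₀ = act Y (arr k 0) := by rw [hε₀, mul_sub, b₀.2, hrad', sub_zero]
  have s₃ : act Y (arr k 3) * ε₂ = act Y (arr k 3) := by rw [hε₂, mul_sub, b₃.2, hrad', sub_zero]
  have t₀ : ε₁ * act Y (arr k 0) = act Y (arr k 0) := by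
    rw [hε₁, sub_mul, b₀.1]; simp only [add_mul, mul_assoc, hrad, mul_zero, add_zero, sub_zero]
  have t₃ : ε₁ * act Y (arr k 3) = act Y (arr k 3) := by
    rw [hε₁, sub_mul, b₃.1]; simp only [add_mul, mul_assoc, hrad, mul_zero, add_zero, sub_zero]
  have z₁ : act Y (arr k 1) * ε₁ = 0 := by
    rw [mul_add, add_mul] at h₄
    rw [hε₁, mul_sub, b₁.2, mul_add, mul_add, ← mul_assoc, ← mul_assoc, ← mul_assoc, h₂, zero_mul,
      add_zero, h₄, sub_self]
  have z₂ : act Y (arr k 2) * ε₁ = 0 := by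
    rw [mul_add, add_mul, mul_assoc, ← h₃] at h₅
    rw [hε₁, mul_sub, b₂.2, mul_add, mul_add, ← mul_assoc _ h, h₁, zero_mul, add_zero,
      ← mul_assoc _ h', h₅, sub_self]
  have w₁ : ε₀ * act Y (arr k 1) = 0 := by rw [hε₀, sub_mul, b₁.1, h₄, sub_self]
  have w₂ : ε₂ * act Y (arr k 2) = 0 := by rw [hε₂, sub_mul, b₂.1, h₅, sub_self]
  have x₀ : ε₀ * (P + H) * act Y (arr k 0) = ε₀ := by
    have := mul_eq_zero_of_source_eq hY (b := 2) (b' := 1) (by decide) rfl (g := ε₀)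
      (f := act Y (vert k 0) * (P + H) * act Y (arr k 0) - act Y (vert k 0))
      (by
        change act Y (vert k 0) * _ = _
        rw [mul_sub, ← mul_assoc, ← mul_assoc, (v 0).1])
      (fun a => by
        by_cases ha : arrowSrc a = 0
        · obtain rfl : a = 0 := by revert ha; decide +revert
          rw [mul_sub, ← mul_assoc, ← mul_assoc, b₀.2, mul_assoc, H₄, sub_self]
        · rw [mul_sub, ← mul_assoc, ← mul_assoc, (v 0).arr_mul_eq_zero (Ne.symm ha), zero_mul,
            zero_mul, sub_zero]) w₁
    rwa [mul_sub, ← mul_assoc, ← mul_assoc, c₀.2, sub_eq_zero] at this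
  have x₂ : ε₂ * (Q + H') * act Y (arr k 3) = ε₂ := by
    have := mul_eq_zero_of_source_eq hY (b := 1) (b' := 2) (by decide) rfl (g := ε₂)
      (f := act Y (vert k 2) * (Q + H') * act Y (arr k 3) - act Y (vert k 2))
      (by
        change act Y (vert k 2) * _ = _
        rw [mul_sub, ← mul_assoc, ← mul_assoc, (v 2).1])
      (fun a => by
        by_cases ha : arrowSrc a = 2
        · obtain rfl : a = 3 := by revert ha; decide +revert
          rw [mul_sub, ← mul_assoc, ← mul_assoc, b₃.2, mul_assoc, H₅, sub_self]
        · rw [mul_sub, ← mul_assoc, ← mul_assoc, (v 2).arr_mul_eq_zero (Ne.symm ha), zero_mul,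
            zero_mul, sub_zero]) w₂
    rwa [mul_sub, ← mul_assoc, ← mul_assoc, c₂.2, sub_eq_zero] at this
  have x₁ : (act Y (arr k 0) * (P + H) + act Y (arr k 3) * Q) * ε₁ = ε₁ := by
    have := mul_eq_zero_of_target_eq hY (a := 0) (b := 3) (by decide) rfl (f := ε₁)
      (g := act Y (arr k 0) * (P + H) + act Y (arr k 3) * Q - 1) c₁.1
      (fun a => by
        fin_cases a
        · exact c₁.arr_mul_eq_zero (by decide)
        · exact z₁
        · exact z₂
        · exact c₁.arr_mul_eq_zero (by decide))
      (by
        rw [sub_mul, add_mul, mul_assoc, H₄, mul_assoc, H₂, mul_zero, add_zero, one_mul,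
          sub_self])
      (by
        rw [mul_add, H₃, sub_mul, add_mul, add_mul, mul_assoc _ P, H₁, mul_zero, zero_add,
          ← add_mul, ← mul_add, add_comm H', mul_assoc, H₅, one_mul, sub_self])
    rwa [sub_mul, one_mul, sub_eq_zero] at this
  have hmid (i j) (f g e : Module.End k Y) (hf : IsBlock j j f) (he : IsBlock i i e) :
      IsBlock i j (f * g * e) :=
    ⟨by rw [← mul_assoc, ← mul_assoc, hf.1], by rw [mul_assoc, he.2]⟩
  obtain ⟨F₄, hF₄, e₄⟩ := exists_factors_regular_zero (hmid 1 0 ε₀ P ε₁ c₀ c₁)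
    (by rw [mul_assoc, t₃, mul_assoc, H₁, mul_zero])
  obtain ⟨F₅, hF₅, e₅⟩ := exists_factors_regular_two (hmid 1 2 ε₂ Q ε₁ c₂ c₁)
    (by rw [mul_assoc, t₀, mul_assoc, H₂, mul_zero])
  obtain ⟨F₆, hF₆, e₆⟩ := exists_factors_dual_one (hmid 1 0 ε₀ H ε₁ c₀ c₁) (hmid 1 2 ε₂ H' ε₁ c₂ c₁)
    (by rw [← mul_assoc, ← mul_assoc, s₀, H₃, ← mul_assoc, ← mul_assoc, s₃])
  have key : act Y (arr k 1) * p + act Y (arr k 2) * q + p * act Y (arr k 1) +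
      (h * act Y (arr k 1) + act Y (arr k 1) * h) + (h' * act Y (arr k 2) + act Y (arr k 2) * h') +
      (act Y (arr k 0) * (ε₀ * P * ε₁) + ε₀ * P * ε₁ * act Y (arr k 0)) +
      (act Y (arr k 3) * (ε₂ * Q * ε₁) + ε₂ * Q * ε₁ * act Y (arr k 3)) +
      (ε₀ * H * ε₁ * act Y (arr k 0) + ε₂ * H' * ε₁ * act Y (arr k 3) +
        act Y (arr k 0) * (ε₀ * H * ε₁)) = 1 := by
    have y₀ : ε₀ * P * ε₁ * act Y (arr k 0) + ε₀ * H * ε₁ * act Y (arr k 0) = ε₀ := by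
      rw [mul_assoc, mul_assoc _ ε₁, t₀, ← add_mul, ← mul_add, x₀]
    have y₂ : ε₂ * Q * ε₁ * act Y (arr k 3) + ε₂ * H' * ε₁ * act Y (arr k 3) = ε₂ := by
      rw [mul_assoc, mul_assoc _ ε₁, t₃, ← add_mul, ← mul_add, x₂]
    have y₁ : act Y (arr k 0) * (ε₀ * P * ε₁) + act Y (arr k 3) * (ε₂ * Q * ε₁) +
        act Y (arr k 0) * (ε₀ * H * ε₁) = ε₁ := by
      simp only [← mul_assoc, s₀, s₃]
      rw [← add_mul, ← add_mul, add_right_comm, ← mul_add, x₁]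
    calc
      _ = act Y (arr k 1) * (p + h) + act Y (arr k 2) * (q + h') +
          (p * act Y (arr k 1) + h * act Y (arr k 1) + h' * act Y (arr k 2)) +
          (ε₀ * P * ε₁ * act Y (arr k 0) + ε₀ * H * ε₁ * act Y (arr k 0)) +
          (ε₂ * Q * ε₁ * act Y (arr k 3) + ε₂ * H' * ε₁ * act Y (arr k 3)) +
          (act Y (arr k 0) * (ε₀ * P * ε₁) + act Y (arr k 3) * (ε₂ * Q * ε₁) +
            act Y (arr k 0) * (ε₀ * H * ε₁)) := by
        rw [mul_add, mul_add]; abel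
      _ = act Y (vert k 0) + act Y (vert k 1) + act Y (vert k 2) := by
        rw [y₀, y₁, y₂, hε₀, hε₁, hε₂]; abel
      _ = 1 := sum_act_vert
  have hid : F₁ + F₂ + F₃ + F₄ + F₅ + F₆ = LinearMap.id := LinearMap.ext fun y => by
    simp only [LinearMap.add_apply, e₁, e₂, e₃, e₄, e₅, e₆]
    exact congr($key y)
  exact FactorsThroughMA.inAdd (hid ▸ ((((hF₁.add hF₂).add hF₃).add hF₄).add hF₅).add hF₆)

end Modules

end AlgA

/-- Every finite-dimensional right `A`-module `X` with `Ext¹_A(A ⊕ D(A), X) = 0`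
lies in `add (A ⊕ D(A))`. -/
theorem mem_add_of_ext_vanishing (k : Type) [Field k]
    (X : Type) [AddCommGroup X] [Module (Aop k) X]
    (hX : Module.Finite (Aop k) X)
    (h : Subsingleton (ExtA k (MA k) X 1)) :
    InAdd k (MA k) X := by
  let : Module k X := Module.compHom X (algebraMap k (Aop k))
  have : IsScalarTower k (Aop k) X :=
    ⟨fun c r x => by rw [Algebra.smul_def, mul_smul]; rfl⟩
  have : Module.Finite k (Aop k) := Module.Finite.equiv (MulOpposite.opLinearEquiv k)
  have : Module.Finite k X := Module.Finite.trans (Aop k) X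
  exact AlgA.inAdd_of_subsingleton_ext h
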